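/- arXiv:1201.2520 — 3 statements merged into one kernel-verified Lean document; each statement's English description precedes it below -/
import Mathlib

section
/- Let φ : SU(3) × SU(2) × U(1) → GL(5, ℂ) be the map sending (A, B, u) to the block-diagonal 5×5 matrix diag(u²·A, u⁻³·B), where SU(n) is the group of n×n complex special unitary matrices and U(1) is the circle group of complex numbers of modulus 1. Then φ is a group homomorphism whose image is contained in SU(5), and its kernel is the cyclic group of order 6 consisting of the elements (ζ⁻²·1₃, ζ³·1₂, ζ) with ζ⁶ = 1. In particular the Standard Model gauge group (SU(3) × SU(2) × U(1))/ℤ₆ embeds as a subgroup of SU(5). -/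
open Matrix

/-- The map `φ : SU(3) × SU(2) × U(1) → GL(5, ℂ)` sending `(A, B, u)` to the block-diagonal
matrix `diag(u²·A, u⁻³·B)`. -/
noncomputable def smEmbed
    (x : Matrix.specialUnitaryGroup (Fin 3) ℂ × Matrix.specialUnitaryGroup (Fin 2) ℂ × Circle) :
    Matrix (Fin 5) (Fin 5) ℂ :=
  Matrix.reindex finSumFinEquiv finSumFinEquiv
    (Matrix.fromBlocks
      ((x.2.2 : ℂ) ^ 2 • (x.1 : Matrix (Fin 3) (Fin 3) ℂ)) 0 0
      (((x.2.2 : ℂ)⁻¹) ^ 3 • (x.2.1 : Matrix (Fin 2) (Fin 2) ℂ)))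

theorem Matrix.smul_mem_unitaryGroup {n : Type*} [Fintype n] [DecidableEq n] {c : ℂ}
    (hc : ‖c‖ = 1) {A : Matrix n n ℂ} (hA : A ∈ Matrix.unitaryGroup n ℂ) :
    c • A ∈ Matrix.unitaryGroup n ℂ := by
  rw [Matrix.mem_unitaryGroup_iff] at hA ⊢
  rw [star_smul, smul_mul_smul_comm, hA, Complex.star_def, Complex.mul_conj,
    Complex.normSq_eq_norm_sq, hc]
  simp

theorem Matrix.fromBlocks_diagonal_mem_unitaryGroup {m n : Type*} [Fintype m] [DecidableEq m]
    [Fintype n] [DecidableEq n] {A : Matrix m m ℂ} {B : Matrix n n ℂ}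
    (hA : A ∈ Matrix.unitaryGroup m ℂ) (hB : B ∈ Matrix.unitaryGroup n ℂ) :
    Matrix.fromBlocks A 0 0 B ∈ Matrix.unitaryGroup (m ⊕ n) ℂ := by
  rw [Matrix.mem_unitaryGroup_iff, Matrix.star_eq_conjTranspose] at *
  simp [Matrix.fromBlocks_conjTranspose, Matrix.fromBlocks_multiply, hA, hB]

theorem Matrix.reindex_mem_unitaryGroup {m n : Type*} [Fintype m] [DecidableEq m]
    [Fintype n] [DecidableEq n] (e : m ≃ n) {A : Matrix m m ℂ}
    (hA : A ∈ Matrix.unitaryGroup m ℂ) :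
    Matrix.reindex e e A ∈ Matrix.unitaryGroup n ℂ := by
  rw [Matrix.mem_unitaryGroup_iff, Matrix.star_eq_conjTranspose] at *
  simp [Matrix.conjTranspose_submatrix, Matrix.submatrix_mul_equiv, hA]

theorem smEmbed_mul
    (x y : Matrix.specialUnitaryGroup (Fin 3) ℂ × Matrix.specialUnitaryGroup (Fin 2) ℂ × Circle) :
    smEmbed (x * y) = smEmbed x * smEmbed y := by
  simp [smEmbed, Matrix.submatrix_mul_equiv, Matrix.fromBlocks_multiply, smul_smul, mul_pow,
    mul_comm]

theorem smEmbed_mem_specialUnitaryGroup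
    (x : Matrix.specialUnitaryGroup (Fin 3) ℂ × Matrix.specialUnitaryGroup (Fin 2) ℂ × Circle) :
    smEmbed x ∈ Matrix.specialUnitaryGroup (Fin 5) ℂ := by
  obtain ⟨⟨A, hA⟩, ⟨B, hB⟩, u⟩ := x
  rw [Matrix.mem_specialUnitaryGroup_iff] at *
  refine ⟨Matrix.reindex_mem_unitaryGroup _ (Matrix.fromBlocks_diagonal_mem_unitaryGroup
    (Matrix.smul_mem_unitaryGroup (by simp [Circle.norm_coe]) hA.1)
    (Matrix.smul_mem_unitaryGroup (by simp [Circle.norm_coe]) hB.1)), ?_⟩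
  rw [smEmbed, Matrix.det_reindex_self, Matrix.det_fromBlocks_zero₂₁, Matrix.det_smul,
    Matrix.det_smul, hA.2, hB.2]
  simp [← pow_mul]

theorem smEmbed_eq_one_iff_blocks
    (x : Matrix.specialUnitaryGroup (Fin 3) ℂ × Matrix.specialUnitaryGroup (Fin 2) ℂ × Circle) :
    smEmbed x = 1 ↔
      (x.1 : Matrix (Fin 3) (Fin 3) ℂ) = (x.2.2 : ℂ)⁻¹ ^ 2 • (1 : Matrix (Fin 3) (Fin 3) ℂ) ∧
      (x.2.1 : Matrix (Fin 2) (Fin 2) ℂ) = (x.2.2 : ℂ) ^ 3 • (1 : Matrix (Fin 2) (Fin 2) ℂ) := by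
  have hu : (x.2.2 : ℂ) ≠ 0 := x.2.2.coe_ne_zero
  have h : (1 : Matrix (Fin 5) (Fin 5) ℂ) =
      Matrix.reindex (finSumFinEquiv (m := 3) (n := 2)) (finSumFinEquiv (m := 3) (n := 2)) 1 := by
    simp
  rw [smEmbed, h, (Matrix.reindex _ _).apply_eq_iff_eq, ← Matrix.fromBlocks_one,
    Matrix.fromBlocks_inj, inv_pow, inv_pow, inv_smul_eq_iff₀ (pow_ne_zero 3 hu),
    eq_inv_smul_iff₀ (pow_ne_zero 2 hu)]
  simp

theorem smEmbed_eq_one_iff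
    (x : Matrix.specialUnitaryGroup (Fin 3) ℂ × Matrix.specialUnitaryGroup (Fin 2) ℂ × Circle) :
    smEmbed x = 1 ↔ ∃ ζ : ℂ, ζ ^ 6 = 1 ∧
        (x.1 : Matrix (Fin 3) (Fin 3) ℂ) = ζ⁻¹ ^ 2 • (1 : Matrix (Fin 3) (Fin 3) ℂ) ∧
        (x.2.1 : Matrix (Fin 2) (Fin 2) ℂ) = ζ ^ 3 • (1 : Matrix (Fin 2) (Fin 2) ℂ) ∧
        (x.2.2 : ℂ) = ζ := by
  rw [smEmbed_eq_one_iff_blocks]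
  constructor
  · rintro ⟨hA, hB⟩
    refine ⟨x.2.2, ?_, hA, hB, rfl⟩
    have hdet := (Matrix.mem_specialUnitaryGroup_iff.1 x.2.1.2).2
    rw [hB, Matrix.det_smul, Matrix.det_one, mul_one, ← pow_mul, Fintype.card_fin] at hdet
    exact hdet
  · rintro ⟨ζ, -, hA, hB, rfl⟩
    exact ⟨hA, hB⟩

theorem exists_smEmbed_eq_one {ζ : ℂ} (hζ : ζ ^ 6 = 1) :
    ∃ x, smEmbed x = 1 ∧ (x.2.2 : ℂ) = ζ := by
  have hnorm : ‖ζ‖ = 1 := Complex.norm_eq_one_of_pow_eq_one hζ (by norm_num)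
  have hA : ζ⁻¹ ^ 2 • (1 : Matrix (Fin 3) (Fin 3) ℂ) ∈ Matrix.specialUnitaryGroup (Fin 3) ℂ :=
    Matrix.mem_specialUnitaryGroup_iff.2
      ⟨Matrix.smul_mem_unitaryGroup (by simp [hnorm]) (one_mem _), by simp [← pow_mul, hζ]⟩
  have hB : ζ ^ 3 • (1 : Matrix (Fin 2) (Fin 2) ℂ) ∈ Matrix.specialUnitaryGroup (Fin 2) ℂ :=
    Matrix.mem_specialUnitaryGroup_iff.2
      ⟨Matrix.smul_mem_unitaryGroup (by simp [hnorm]) (one_mem _), by simp [← pow_mul, hζ]⟩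
  exact ⟨(⟨_, hA⟩, ⟨_, hB⟩, ⟨ζ, mem_sphere_zero_iff_norm.2 hnorm⟩),
    (smEmbed_eq_one_iff_blocks _).2 ⟨rfl, rfl⟩, rfl⟩

/-- `smEmbed` as a monoid homomorphism. -/
noncomputable def smEmbedHom :
    Matrix.specialUnitaryGroup (Fin 3) ℂ × Matrix.specialUnitaryGroup (Fin 2) ℂ × Circle →*
      Matrix (Fin 5) (Fin 5) ℂ where
  toFun := smEmbed
  map_one' := by simp [smEmbed]
  map_mul' := smEmbed_mul

theorem injOn_circle_ker_smEmbed :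
    Set.InjOn (fun x : Matrix.specialUnitaryGroup (Fin 3) ℂ ×
      Matrix.specialUnitaryGroup (Fin 2) ℂ × Circle => (x.2.2 : ℂ)) {x | smEmbed x = 1} := by
  rintro x hx y hy hxy
  obtain ⟨hA, hB⟩ := (smEmbed_eq_one_iff_blocks x).1 hx
  obtain ⟨hA', hB'⟩ := (smEmbed_eq_one_iff_blocks y).1 hy
  dsimp only at hxy
  rw [hxy, ← hA'] at hA
  rw [hxy, ← hB'] at hB
  exact Prod.ext (Subtype.ext hA) (Prod.ext (Subtype.ext hB) (Circle.ext hxy))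

theorem ncard_ker_smEmbed : {x | smEmbed x = 1}.ncard = 6 := by
  have himage : (fun x : Matrix.specialUnitaryGroup (Fin 3) ℂ ×
      Matrix.specialUnitaryGroup (Fin 2) ℂ × Circle => (x.2.2 : ℂ)) '' {x | smEmbed x = 1} =
      (Polynomial.nthRootsFinset 6 (1 : ℂ) : Set ℂ) := by
    ext ζ
    rw [Finset.mem_coe, Polynomial.mem_nthRootsFinset (by norm_num)]
    constructor
    · rintro ⟨x, hx, rfl⟩
      obtain ⟨ζ, hζ, -, -, h⟩ := (smEmbed_eq_one_iff x).1 hx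
      rwa [← h] at hζ
    · exact fun hζ => exists_smEmbed_eq_one hζ
  rw [← injOn_circle_ker_smEmbed.ncard_image, himage, Set.ncard_coe_finset,
    (Complex.isPrimitiveRoot_exp 6 (by norm_num)).card_nthRootsFinset]

theorem exists_generator_ker_smEmbed :
    ∃ g, smEmbed g = 1 ∧ ∀ x, smEmbed x = 1 → ∃ k : ℕ, x = g ^ k := by
  have hfin : Finite smEmbedHom.ker :=
    Set.finite_of_ncard_ne_zero (s := {x | smEmbed x = 1}) (by simp [ncard_ker_smEmbed])
  let f : smEmbedHom.ker →* ℂ := Circle.coeHom.comp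
    (((MonoidHom.snd _ _).comp (MonoidHom.snd _ _)).comp smEmbedHom.ker.subtype)
  have hcyc : IsCyclic smEmbedHom.ker := 
    isCyclic_of_injective_ringHom f fun x y h => Subtype.ext (injOn_circle_ker_smEmbed x.2 y.2 h)
  obtain ⟨g, hg⟩ := IsCyclic.exists_generator (α := smEmbedHom.ker)
  refine ⟨g, g.2, fun x hx => ?_⟩
  obtain ⟨k, hk⟩ := mem_powers_iff_mem_zpowers.2 (hg ⟨x, hx⟩)
  exact ⟨k, (congrArg Subtype.val hk).symm⟩

/-- The map `(A, B, u) ↦ diag(u²·A, u⁻³·B)` is a group homomorphism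
`SU(3) × SU(2) × U(1) → GL(5, ℂ)` whose image lies in `SU(5)`, and whose kernel is the cyclic
group of order `6` consisting of the elements `(ζ⁻²·1₃, ζ³·1₂, ζ)` with `ζ⁶ = 1`.  In particular
the Standard Model gauge group `(SU(3) × SU(2) × U(1))/ℤ₆` embeds as a subgroup of `SU(5)`. -/
theorem standardModel_embeds_in_su5 :
    smEmbed 1 = 1 ∧
    (∀ x y, smEmbed (x * y) = smEmbed x * smEmbed y) ∧
    (∀ x, smEmbed x ∈ Matrix.specialUnitaryGroup (Fin 5) ℂ) ∧
    (∀ x, smEmbed x = 1 ↔ ∃ ζ : ℂ, ζ ^ 6 = 1 ∧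
        (x.1 : Matrix (Fin 3) (Fin 3) ℂ) = ζ⁻¹ ^ 2 • (1 : Matrix (Fin 3) (Fin 3) ℂ) ∧
        (x.2.1 : Matrix (Fin 2) (Fin 2) ℂ) = ζ ^ 3 • (1 : Matrix (Fin 2) (Fin 2) ℂ) ∧
        (x.2.2 : ℂ) = ζ) ∧
    {x | smEmbed x = 1}.ncard = 6 ∧
    (∃ g, smEmbed g = 1 ∧ ∀ x, smEmbed x = 1 → ∃ k : ℕ, x = g ^ k) := by
  exact ⟨smEmbedHom.map_one, smEmbed_mul, smEmbed_mem_specialUnitaryGroup, smEmbed_eq_one_iff,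
    ncard_ker_smEmbed, exists_generator_ker_smEmbed⟩
end

section
/- Let R = ℤ[a₀, a₂, a₃, a₄, a₅, z] and let Δ ∈ R be the discriminant of the Weierstrass curve over R with coefficients (a₁, a₂, a₃, a₄, a₆) = (a₅, a₄z, a₃z², a₂z³, a₀z⁵). Then Δ ≡ −a₅⁴·(a₀a₅² − a₂a₃a₅ + a₃²a₄)·z⁵ (mod z⁶) in R, i.e. z⁶ divides Δ + a₅⁴(a₀a₅² − a₂a₃a₅ + a₃²a₄)z⁵. (This identifies the curve a₀a₅² − a₂a₃a₅ + a₃²a₄ = 0 in the z = 0 locus as the locus Σ₅ where the discriminant vanishes to higher order, i.e. the matter curve on which the 5 and 5̄ matter of the SU(5) GUT propagates.) -/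
open MvPolynomial

/-- The coefficient `a₀` in the unfolding of the `E₈` singularity. -/
noncomputable def a0 : MvPolynomial (Fin 6) ℤ := X 0
/-- The coefficient `a₂`. -/
noncomputable def a2 : MvPolynomial (Fin 6) ℤ := X 1
/-- The coefficient `a₃`. -/
noncomputable def a3 : MvPolynomial (Fin 6) ℤ := X 2
/-- The coefficient `a₄`. -/
noncomputable def a4 : MvPolynomial (Fin 6) ℤ := X 3
/-- The coefficient `a₅`. -/
noncomputable def a5 : MvPolynomial (Fin 6) ℤ := X 4
/-- The coordinate `z` on the base, vanishing on the GUT surface `S`. -/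
noncomputable def z : MvPolynomial (Fin 6) ℤ := X 5

/-- The Weierstrass curve `y² + a₅xy + a₃z²y = x³ + a₄zx² + a₂z³x + a₀z⁵`, the unfolding of the
`E₈` singularity with unbroken `SU(5)`. -/
noncomputable def W : WeierstrassCurve (MvPolynomial (Fin 6) ℤ) :=
  ⟨a5, a4 * z, a3 * z ^ 2, a2 * z ^ 3, a0 * z ^ 5⟩


/-- The discriminant of the `E₈`-unfolding Weierstrass curve satisfies
`Δ ≡ −a₅⁴·(a₀a₅² − a₂a₃a₅ + a₃²a₄)·z⁵ (mod z⁶)`, identifying the matter curve `Σ₅`. -/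
theorem discriminant_mod_z_pow_six :
    z ^ 6 ∣ W.Δ + a5 ^ 4 * (a0 * a5 ^ 2 - a2 * a3 * a5 + a3 ^ 2 * a4) * z ^ 5 := by
  exact ⟨-(8 * a5 ^ 2 * a4 + 16 * a4 ^ 2 * z) * (a0 * a5 ^ 2 - a2 * a3 * a5 + a3 ^ 2 * a4)
      - (a5 ^ 2 + 4 * a4 * z) ^ 2 * (4 * a0 * a4 - a2 ^ 2)
      - 8 * (a3 * a5 + 2 * a2 * z) ^ 3 - 27 * z ^ 2 * (a3 ^ 2 + 4 * a0 * z) ^ 2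
      + 9 * (a5 ^ 2 + 4 * a4 * z) * (a3 * a5 + 2 * a2 * z) * (a3 ^ 2 + 4 * a0 * z), by
    simp only [W, WeierstrassCurve.Δ, WeierstrassCurve.b₂, WeierstrassCurve.b₄,
      WeierstrassCurve.b₆, WeierstrassCurve.b₈]
    ring⟩
end

section
/- Let R = ℤ[a₀, a₂, a₃, a₄, a₅, z] and let Δ ∈ R be the discriminant of the Weierstrass curve over R with coefficients (a₁, a₂, a₃, a₄, a₆) = (a₅, a₄z, a₃z², a₂z³, a₀z⁵). Let P = a₀a₅² − a₂a₃a₅ + a₃²a₄. Then, modulo the ideal of R generated by P and z⁷, one has Δ ≡ a₅³·(a₃³ + a₂²a₅ − 4a₀a₄a₅)·z⁶. In particular, at a generic point of the curve P = 0 (where a₅ and a₃³ + a₂²a₅ − 4a₀a₄a₅ are nonzero) the discriminant vanishes along z = 0 to order exactly 6, corresponding to the enhancement of the A₄ singularity of the ALE fiber to A₅ along the matter curve Σ₅. -/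
open MvPolynomial

/-- Modulo the ideal generated by the `Σ₅` matter-curve polynomial
`P = a₀a₅² − a₂a₃a₅ + a₃²a₄` and `z⁷`, the discriminant of the `E₈`-unfolding Weierstrass curve
satisfies `Δ ≡ a₅³·(a₃³ + a₂²a₅ − 4a₀a₄a₅)·z⁶`: along the matter curve `Σ₅` the `A₄` singularity
enhances to `A₅` and the discriminant generically vanishes to order exactly `6` along `z = 0`. -/
theorem discriminant_mod_matter_curve :
    W.Δ - a5 ^ 3 * (a3 ^ 3 + a2 ^ 2 * a5 - 4 * a0 * a4 * a5) * z ^ 6 ∈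
      Ideal.span ({a0 * a5 ^ 2 - a2 * a3 * a5 + a3 ^ 2 * a4, z ^ 7} :
        Set (MvPolynomial (Fin 6) ℤ)) := by
  rw [Ideal.mem_span_pair]
  refine ⟨-(a5 ^ 2 + 4 * a4 * z) ^ 2 * z ^ 5,
    -(4 * a0 * a4 - a2 ^ 2) * (8 * a5 ^ 2 * a4 + 16 * a4 ^ 2 * z)
      - 8 * (6 * a2 * (a3 * a5) ^ 2 + 12 * a2 ^ 2 * (a3 * a5) * z + 8 * a2 ^ 3 * z ^ 2)
      - 27 * z * (a3 ^ 2 + 4 * a0 * z) ^ 2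
      + 9 * (4 * a4 * (a3 * a5 + 2 * a2 * z) * (a3 ^ 2 + 4 * a0 * z)
        + a5 ^ 2 * (2 * a2 * (a3 ^ 2 + 4 * a0 * z) + 4 * a0 * (a3 * a5))), ?_⟩
  simp only [W, WeierstrassCurve.Δ, WeierstrassCurve.b₂, WeierstrassCurve.b₄,
    WeierstrassCurve.b₆, WeierstrassCurve.b₈]
  ring
end
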